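/- Extension of Dedekind's theorem: Let G be a finite abelian group with unit element e and H a subgroup. For every h ∈ H there exists a homogeneous polynomial A_h ∈ ℂ[x_g; g ∈ G] of degree [G:H] such that, in the group algebra ℂ[x_g][H], Θ(G)·e = ∏_{χ ∈ Ĥ} ∑_{h ∈ H} χ(h) A_h h. Moreover, if H = G one can take A_h = x_h. -/

import Mathlib

namespace DedekindExt

open MvPolynomial

variable {G : Type*} [CommGroup G] [Fintype G]

/-- A character as a monoid hom into the polynomial ring. -/
noncomputable def chr (φ : G →* ℂˣ) : G →* MvPolynomial G ℂ :=
  (C : ℂ →+* MvPolynomial G ℂ).toMonoidHom.comp ((Units.coeHom ℂ).comp φ)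

lemma chr_apply (φ : G →* ℂˣ) (g : G) : chr φ g = C (φ g : ℂ) := rfl

lemma chr_injective : Function.Injective (chr (G := G)) := by
  intro φ ψ h
  ext g
  have := DFunLike.congr_fun h g
  rw [chr_apply, chr_apply] at this
  exact C_injective _ _ this

/-- The eigenvalue of the group matrix at a character. -/
noncomputable def lam (φ : G →* ℂˣ) : MvPolynomial G ℂ := ∑ g : G, chr φ g * X g

lemma dedekind [DecidableEq G] [Fintype (G →* ℂˣ)] :
    Matrix.det (Matrix.of fun g h : G => (X (g * h⁻¹) : MvPolynomial G ℂ)) =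
      ∏ φ : G →* ℂˣ, lam φ := by
  obtain ⟨e⟩ := CommGroup.monoidHom_mulEquiv_of_hasEnoughRootsOfUnity G ℂ
  set M := (Matrix.of fun g h : G => (X (g * h⁻¹) : MvPolynomial G ℂ)) with hM
  let Q : Matrix G G (MvPolynomial G ℂ) := Matrix.of fun i h => chr (e.symm i) h
  have hQ : Q.det ≠ 0 := by
    intro h0
    obtain ⟨v, hv, hv0⟩ := Matrix.exists_vecMul_eq_zero_iff.2 h0
    have hli := (linearIndependent_monoidHom G (MvPolynomial G ℂ)).comp
      (fun i : G => chr (e.symm i)) (chr_injective.comp e.symm.injective)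
    rw [Fintype.linearIndependent_iff] at hli
    apply hv
    funext i
    refine hli v ?_ i
    funext h
    have := congrFun hv0 h
    simpa [Matrix.vecMul, dotProduct, Q] using this
  have hmul : Q * M = Matrix.diagonal (fun i => lam (e.symm i)) * Q := by
    ext1 i h
    rw [Matrix.mul_apply, Matrix.diagonal_mul, lam, Finset.sum_mul,
      ← Equiv.sum_comp (Equiv.mulRight h)]
    refine Finset.sum_congr rfl fun k _ => ?_
    simp only [Equiv.coe_mulRight, hM, Matrix.of_apply, Q, map_mul, mul_inv_cancel_right]
    ring
  have hd := congrArg Matrix.det hmul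
  rw [Matrix.det_mul, Matrix.det_mul, Matrix.det_diagonal, mul_comm] at hd
  rw [mul_right_cancel₀ hQ hd]
  exact Equiv.prod_comp e.symm.toEquiv (fun φ => lam φ)

/-- Twisting the group algebra by a character. -/
noncomputable def tw (φ : G →* ℂˣ) :
    MonoidAlgebra (MvPolynomial G ℂ) G →ₐ[MvPolynomial G ℂ] MonoidAlgebra (MvPolynomial G ℂ) G :=
  MonoidAlgebra.lift _ _ _
    { toFun := fun g => MonoidAlgebra.single g (chr φ g)
      map_one' := by simp [MonoidAlgebra.one_def]
      map_mul' := by intro a b; simp [MonoidAlgebra.single_mul_single] }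

lemma tw_single (φ : G →* ℂˣ) (g : G) (r : MvPolynomial G ℂ) :
    tw φ (MonoidAlgebra.single g r) = MonoidAlgebra.single g (chr φ g * r) := by
  simp [tw, mul_comm]

lemma eq_sum (x : MonoidAlgebra (MvPolynomial G ℂ) G) :
    x = ∑ g : G, MonoidAlgebra.single g (x.coeff g) := by
  classical
  ext1
  ext1 g
  simp [MonoidAlgebra.coeff_sum, Finsupp.finsetSum_apply, Finsupp.single_apply]

lemma coeff_tw (φ : G →* ℂˣ) (x : MonoidAlgebra (MvPolynomial G ℂ) G) (g : G) :
    (tw φ x).coeff g = chr φ g * x.coeff g := by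
  classical
  conv_lhs => rw [eq_sum x]
  simp [tw_single, MonoidAlgebra.coeff_sum, Finsupp.finsetSum_apply, Finsupp.single_apply]

lemma tw_tw (φ ψ : G →* ℂˣ) (x : MonoidAlgebra (MvPolynomial G ℂ) G) :
    tw φ (tw ψ x) = tw (φ * ψ) x := by
  ext1
  ext1 g
  simp [coeff_tw, chr_apply, mul_assoc]

lemma coeff_eq_zero_of_tw {φ : G →* ℂˣ} {x : MonoidAlgebra (MvPolynomial G ℂ) G} {g : G}
    (h : tw φ x = x) (hg : φ g ≠ 1) : x.coeff g = 0 := by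
  have h1 := coeff_tw φ x g
  rw [h] at h1
  have h2 : (chr φ g - 1) * x.coeff g = 0 := by rw [sub_mul, ← h1]; ring
  rcases mul_eq_zero.1 h2 with h3 | h3
  · exfalso
    apply hg
    rw [sub_eq_zero, chr_apply, ← C_1] at h3
    exact Units.ext (C_injective _ _ h3)
  · exact h3

/-- The generic element of the group algebra. -/
noncomputable def gen : MonoidAlgebra (MvPolynomial G ℂ) G :=
  ∑ g : G, MonoidAlgebra.single g (X g)

lemma coeff_gen (g : G) : (gen (G := G)).coeff g = X g := by
  classical
  simp [gen, MonoidAlgebra.coeff_sum, Finsupp.finsetSum_apply, Finsupp.single_apply]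

lemma coeff_mul (x y : MonoidAlgebra (MvPolynomial G ℂ) G) (g : G) :
    (x * y).coeff g = ∑ k : G, x.coeff k * y.coeff (k⁻¹ * g) := by
  classical
  conv_lhs => rw [eq_sum x]
  rw [Finset.sum_mul, MonoidAlgebra.coeff_sum, Finsupp.finsetSum_apply]
  refine Finset.sum_congr rfl fun k _ => ?_
  simp [MonoidAlgebra.coeff_single_mul_apply]

lemma homog (s : Finset (G →* ℂˣ)) (g : G) :
    ((∏ φ ∈ s, tw φ gen).coeff g).IsHomogeneous s.card := by
  classical
  induction s using Finset.induction_on generalizing g with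
  | empty =>
    simp only [Finset.prod_empty, MonoidAlgebra.one_def, MonoidAlgebra.coeff_single,
      Finsupp.single_apply, Finset.card_empty]
    split_ifs
    · exact isHomogeneous_one _ _
    · exact isHomogeneous_zero _ _ _
  | insert a s ha ih =>
    rw [Finset.prod_insert ha, coeff_mul, Finset.card_insert_of_notMem ha, add_comm]
    refine IsHomogeneous.sum _ _ _ fun k _ => ?_
    refine IsHomogeneous.mul ?_ (ih _)
    rw [coeff_tw, coeff_gen, chr_apply]
    simpa using (isHomogeneous_C G ((a k : ℂˣ) : ℂ)).mul (isHomogeneous_X ℂ k)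

lemma prod_all [DecidableEq G] [Fintype (G →* ℂˣ)] :
    ∏ φ : G →* ℂˣ, tw φ (gen (G := G)) = MonoidAlgebra.single 1
      (Matrix.det (Matrix.of fun g h : G => (X (g * h⁻¹) : MvPolynomial G ℂ))) := by
  set N := ∏ φ : G →* ℂˣ, tw φ (gen (G := G)) with hN
  have hinv : ∀ ψ : G →* ℂˣ, tw ψ N = N := by
    intro ψ
    rw [hN, map_prod]
    simp only [tw_tw]
    exact Equiv.prod_comp (Equiv.mulLeft ψ) (fun φ => tw φ (gen (G := G)))
  have h1 : N = MonoidAlgebra.single 1 (N.coeff 1) := by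
    ext1
    ext1 g
    rw [MonoidAlgebra.coeff_single, Finsupp.single_apply]
    split_ifs with h
    · rw [h]
    · obtain ⟨φ, hφ⟩ := CommGroup.exists_apply_ne_one_of_hasEnoughRootsOfUnity G ℂ (Ne.symm h)
      exact coeff_eq_zero_of_tw (hinv φ) hφ
  let ε := MonoidAlgebra.lift (MvPolynomial G ℂ) (MvPolynomial G ℂ) G 1
  have h2 : ε N = ∏ φ : G →* ℂˣ, lam φ := by
    rw [hN, map_prod]
    refine Finset.prod_congr rfl fun φ _ => ?_
    simp [gen, map_sum, tw_single, ε, lam]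
  rw [dedekind, ← h2]
  conv_lhs => rw [h1]
  conv_rhs => rw [h1]
  simp [ε]

end DedekindExt

open DedekindExt in

/-- Extension of Dedekind's theorem: for a finite abelian group `G` and subgroup `H`,
there are homogeneous polynomials `A_h` of degree `[G : H]` with
`Θ(G)·e = ∏_{χ ∈ Ĥ} ∑_{h ∈ H} χ(h) A_h h` in the group algebra `ℂ[x_g][H]`;
if `H = G` one can take `A_h = x_h`. -/
theorem dedekind_extension (G : Type*) [CommGroup G] [Fintype G] [DecidableEq G]
    (H : Subgroup G) [Fintype (H →* ℂˣ)] [Fintype H] :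
    ∃ A : H → MvPolynomial G ℂ,
      (∀ h : H, (A h).IsHomogeneous H.index) ∧
      (MonoidAlgebra.single (1 : H)
          (Matrix.det (Matrix.of fun g h : G => (MvPolynomial.X (g * h⁻¹) : MvPolynomial G ℂ)))
        = ∏ χ : H →* ℂˣ,
            ∑ h : H, MonoidAlgebra.single h ((χ h : ℂ) • A h)) ∧
      (H = ⊤ → ∀ h : H, A h = MvPolynomial.X (h : G)) := by
  classical

  have : Fintype (G →* ℂˣ) := Fintype.ofFinite _
  let r : (G →* ℂˣ) →* (H →* ℂˣ) := MonoidHom.domRestrictHom H ℂˣ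
  have hr : ∀ (φ : G →* ℂˣ) (h : H), r φ h = φ h := fun φ h => rfl
  let S : Finset (G →* ℂˣ) := Finset.univ.filter fun φ => r φ = 1
  have hScard : S.card = H.index := by
    rw [Subgroup.index, ← CommGroup.card_domRestrictHom_ker ℂ H, Nat.card_eq_fintype_card,
      Fintype.card_subtype]
    refine congrArg Finset.card (Finset.ext fun φ => ?_)
    simp only [S, Finset.mem_filter, Finset.mem_univ, true_and]
    exact Iff.rfl
  let a := ∏ φ ∈ S, tw φ (gen (G := G))
  have hfib : ∀ ψ : G →* ℂˣ, tw ψ a =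
      ∏ φ ∈ Finset.univ.filter (fun φ => r φ = r ψ), tw φ (gen (G := G)) := by
    intro ψ
    rw [map_prod]
    simp only [tw_tw]
    refine Finset.prod_bij' (fun φ _ => ψ * φ) (fun φ _ => ψ⁻¹ * φ) ?_ ?_ ?_ ?_ ?_
    · intro φ hφ
      simp only [S, Finset.mem_filter, Finset.mem_univ, true_and] at hφ ⊢
      rw [map_mul, hφ]
      exact mul_one (r ψ)
    · intro φ hφ
      simp only [S, Finset.mem_filter, Finset.mem_univ, true_and] at hφ ⊢
      rw [map_mul, hφ, ← map_mul]
      exact (congrArg r (inv_mul_cancel ψ)).trans (map_one r)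
    · intro φ _; exact inv_mul_cancel_left ψ φ
    · intro φ _; exact mul_inv_cancel_left ψ φ
    · intro φ _; rfl
  have hsupp : ∀ g : G, g ∉ H → a.coeff g = 0 := by
    intro g hg
    rw [← CommGroup.forall_monoidHom_apply_eq_one_iff ℂ H g] at hg
    push Not at hg
    obtain ⟨ψ, hψ, hg⟩ := hg
    refine coeff_eq_zero_of_tw (φ := ψ) ?_ hg
    have : r ψ = 1 := by
      ext h
      rw [hr, hψ h h.2]; rfl
    rw [hfib, this]
  refine ⟨fun h => a.coeff h, fun h => hScard ▸ homog S h, ?_, ?_⟩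
  · let ι := MonoidAlgebra.mapDomainRingHom (MvPolynomial G ℂ) H.subtype
    have hι : Function.Injective ι := MonoidAlgebra.mapDomain_injective H.subtype_injective
    have hιs : ∀ h p, ι (MonoidAlgebra.single h p) = MonoidAlgebra.single (h : G) p := by
      intro h p
      simp [ι]
    apply hι
    rw [hιs, OneMemClass.coe_one, ← prod_all, map_prod,
      ← Finset.prod_fiberwise Finset.univ r (fun φ => tw φ (gen (G := G)))]
    refine Finset.prod_congr rfl fun χ _ => ?_
    obtain ⟨ψ, hψ⟩ := MonoidHom.domRestrict_surjective (M := ℂ) H χ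
    have hψ' : r ψ = χ := hψ
    rw [← hψ', ← hfib, map_sum]
    simp only [hιs, hr]
    ext1
    ext1 g
    rw [coeff_tw, MonoidAlgebra.coeff_sum, Finsupp.finsetSum_apply]
    simp only [MonoidAlgebra.coeff_single, Finsupp.single_apply]
    by_cases hg : g ∈ H
    · rw [Finset.sum_eq_single (⟨g, hg⟩ : H)]
      · simp [chr_apply, MvPolynomial.smul_eq_C_mul]
      · intro b _ hb
        rw [if_neg]
        rintro rfl
        exact hb rfl
      · simp
    · rw [hsupp g hg, mul_zero, Finset.sum_eq_zero]
      intro b _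
      rw [if_neg]
      rintro rfl
      exact hg b.2
  · intro hH h
    have hS : S = {1} := by
      ext φ
      simp only [S, Finset.mem_filter, Finset.mem_univ, true_and, Finset.mem_singleton]
      constructor
      · intro hφ
        ext g
        have := DFunLike.congr_fun hφ (⟨g, hH ▸ Subgroup.mem_top g⟩ : H)
        rw [hr] at this
        simpa using congrArg Units.val this
      · rintro rfl; exact map_one r
    simp only [a, hS, Finset.prod_singleton, coeff_tw, coeff_gen, chr_apply]
    simp
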